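/- Let p ∈ (1,∞) and let (X,d) be a complete uniformly p-convex metric space. Suppose (x_n) converges weakly sequentially to x. Then there is a subsequence (x_{m_n}) of (x_n) such that for every N ∈ ℕ the function y ↦ (1/N)·∑_{n=1}^N d(x_{m_n},y)^p has a unique minimizer b_N ∈ X, and b_N → x in the metric as N → ∞. In particular, (X,d) satisfies the p-Banach–Saks property. -/

import Mathlib

open Filter Topology Metric Set MeasureTheory
open scoped ENNReal

section Defs

variable (X : Type) [MetricSpace X]

/-- `m` is a midpoint of `x` and `y`. -/
def IsMidpoint {X : Type} [MetricSpace X] (x y m : X) : Prop :=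
  dist x m = dist x y / 2 ∧ dist y m = dist x y / 2

/-- `(X,d)` admits midpoints. -/
def AdmitsMidpoints : Prop := ∀ x y : X, ∃ m, IsMidpoint x y m

/-- The `p`-mean of two nonnegative reals, `p ∈ [1,∞]`. -/
noncomputable def pMean (p : ℝ≥0∞) (a b : ℝ) : ℝ :=
  if p = ∞ then max a b else ((a ^ p.toReal + b ^ p.toReal) / 2) ^ (1 / p.toReal)

/-- `p`-convexity. -/
def PConvex (p : ℝ≥0∞) : Prop :=
  AdmitsMidpoints X ∧ ∀ x y z m : X, IsMidpoint x y m →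
    dist m z ≤ pMean p (dist x z) (dist y z)

/-- strict `p`-convexity. -/
def StrictlyPConvex (p : ℝ≥0∞) : Prop :=
  AdmitsMidpoints X ∧ ∀ x y z m : X, IsMidpoint x y m →
    (if p = 1 then |dist x z - dist y z| < dist x y else x ≠ y) →
    dist m z < pMean p (dist x z) (dist y z)

/-- uniform `p`-convexity. -/
def UniformlyPConvex (p : ℝ≥0∞) : Prop :=
  AdmitsMidpoints X ∧ ∀ ε : ℝ, 0 < ε → ∃ ρ : ℝ, ρ ∈ Set.Ioo (0:ℝ) 1 ∧
    ∀ x y z m : X, IsMidpoint x y m →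
      (if p = 1 then |dist x z - dist y z| + ε * pMean 1 (dist x z) (dist y z) < dist x y
        else ε * pMean p (dist x z) (dist y z) < dist x y) →
      dist m z ≤ (1 - ρ) * pMean p (dist x z) (dist y z)

/-- Busemann non-positive curvature condition. -/
def Busemann : Prop :=
  AdmitsMidpoints X ∧ ∀ x₀ x₁ y₀ y₁ xm ym : X,
    IsMidpoint x₀ x₁ xm → IsMidpoint y₀ y₁ ym →
      dist xm ym ≤ (dist x₀ y₀ + dist x₁ y₁) / 2

/-- `γ` (restricted to `[0,1]`) is a geodesic from `x` to `y`. -/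
def IsGeodesic {X : Type} [MetricSpace X] (γ : ℝ → X) (x y : X) : Prop :=
  γ 0 = x ∧ γ 1 = y ∧ ∀ s ∈ Set.Icc (0:ℝ) 1, ∀ t ∈ Set.Icc (0:ℝ) 1,
    dist (γ s) (γ t) = |s - t| * dist x y

/-- A subset is (geodesically) convex if it contains all geodesics between its points. -/
def GConvex {X : Type} [MetricSpace X] (C : Set X) : Prop :=
  ∀ x ∈ C, ∀ y ∈ C, ∀ γ : ℝ → X, IsGeodesic γ x y → ∀ t ∈ Set.Icc (0:ℝ) 1, γ t ∈ C

/-- The convex hull: the smallest convex set containing `A`. -/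
def gConvexHull {X : Type} [MetricSpace X] (A : Set X) : Set X :=
  ⋂₀ {C : Set X | GConvex C ∧ A ⊆ C}

/-- `∞`-convexity. -/
def InftyConvex : Prop :=
  AdmitsMidpoints X ∧ ∀ x y z m : X, IsMidpoint x y m →
    dist m z ≤ max (dist x z) (dist y z)

/-- strict `∞`-convexity. -/
def StrictlyInftyConvex : Prop :=
  AdmitsMidpoints X ∧ ∀ x y z m : X, IsMidpoint x y m → x ≠ y →
    dist m z < max (dist x z) (dist y z)

/-- uniform `∞`-convexity. -/
def UniformlyInftyConvex : Prop :=
  AdmitsMidpoints X ∧ ∀ ε : ℝ, 0 < ε → ∃ ρ : ℝ, ρ ∈ Set.Ioo (0:ℝ) 1 ∧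
    ∀ x y z m : X, IsMidpoint x y m →
      ε * max (dist x z) (dist y z) < dist x y →
      dist m z ≤ (1 - ρ) * max (dist x z) (dist y z)

/-- `ρ` works as a modulus of nearly uniform convexity for the parameters `ε`, `R`:
for every infinite `ε`-separated family in a ball of radius `r ≤ R` around `y`, the ball
`B_{(1-ρ)r}(y)` intersects the closed convex hull of the family. -/
def NUCModulus (ε R ρ : ℝ) : Prop :=
  ∀ (ι : Type) [Infinite ι], ∀ (x : ι → X) (y : X) (r : ℝ), r ≤ R →
    (∀ i j : ι, i ≠ j → ε ≤ dist (x i) (x j)) → (∀ i, dist (x i) y ≤ r) →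
    (Metric.closedBall y ((1 - ρ) * r) ∩ closure (gConvexHull (Set.range x))).Nonempty

/-- Nearly uniform convexity. -/
def NearlyUniformlyConvex : Prop :=
  InftyConvex X ∧ ∀ R : ℝ, 0 < R → ∀ ε : ℝ, 0 < ε → ∃ ρ : ℝ, 0 < ρ ∧ NUCModulus X ε R ρ

/-- Reflexivity: every decreasing directed family of nonempty bounded closed convex sets
has nonempty intersection. -/
def MetricReflexive : Prop :=
  ∀ (I : Type) [Nonempty I] [Preorder I] [IsDirected I (· ≤ ·)], ∀ C : I → Set X,
    (∀ i, (C i).Nonempty) → (∀ i, Bornology.IsBounded (C i)) → (∀ i, IsClosed (C i)) →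
    (∀ i, GConvex (C i)) → (∀ i j : I, j ≤ i → C i ⊆ C j) → (⋂ i, C i).Nonempty

/-- The co-convex topology: the weakest topology containing all complements of closed
convex sets. -/
def coConvexTopology : TopologicalSpace X :=
  TopologicalSpace.generateFrom {U : Set X | ∃ C : Set X, IsClosed C ∧ GConvex C ∧ U = Cᶜ}

/-- The set of limit points of the sequence `x` in the co-convex topology. -/
def coLim {X : Type} [MetricSpace X] (x : ℕ → X) : Set X :=
  {a : X | Filter.Tendsto x Filter.atTop (@nhds X (coConvexTopology X) a)}

/-- Countable reflexivity. -/
def CountableReflexive : Prop :=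
  MetricReflexive X ∧ ∀ x : ℕ → X, (coLim x).Nonempty →
    ∃ φ : ℕ → ℕ, StrictMono φ ∧
      coLim x = ⋂ m : ℕ, closure (gConvexHull ((fun n => x (φ n)) '' Set.Ici m))

/-- Quasi-convexity: all sublevel sets are convex. -/
def GQuasiConvex {X : Type} [MetricSpace X] (f : X → ℝ) : Prop :=
  ∀ c : ℝ, GConvex {x : X | f x ≤ c}

/-- Quasi-monotonicity: both quasi-convex and quasi-concave. -/
def GQuasiMonotone {X : Type} [MetricSpace X] (f : X → ℝ) : Prop :=
  GQuasiConvex f ∧ GQuasiConvex (fun x => -f x)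

/-- The `p`-mean for real `p ∈ [1,∞)`. -/
noncomputable def pMeanR (p a b : ℝ) : ℝ := ((a ^ p + b ^ p) / 2) ^ (1 / p)

/-- `p`-convexity for real `p`. -/
def PConvexR (p : ℝ) : Prop :=
  AdmitsMidpoints X ∧ ∀ x y z m : X, IsMidpoint x y m →
    dist m z ≤ pMeanR p (dist x z) (dist y z)

/-- strict `p`-convexity for real `p`. -/
def StrictlyPConvexR (p : ℝ) : Prop :=
  AdmitsMidpoints X ∧ ∀ x y z m : X, IsMidpoint x y m →
    (if p = 1 then |dist x z - dist y z| < dist x y else x ≠ y) →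
    dist m z < pMeanR p (dist x z) (dist y z)

/-- uniform `p`-convexity for real `p`. -/
def UniformlyPConvexR (p : ℝ) : Prop :=
  AdmitsMidpoints X ∧ ∀ ε : ℝ, 0 < ε → ∃ ρ : ℝ, ρ ∈ Set.Ioo (0:ℝ) 1 ∧
    ∀ x y z m : X, IsMidpoint x y m →
      ε * pMeanR p (dist x z) (dist y z) < dist x y →
      dist m z ≤ (1 - ρ) * pMeanR p (dist x z) (dist y z)

/-- `ω(z,(x_n)) = limsup_n d(z,x_n)`. -/
noncomputable def asymRadius {X : Type} [MetricSpace X] (x : ℕ → X) (z : X) : ℝ :=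
  Filter.limsup (fun n => dist z (x n)) Filter.atTop

/-- `a` is the (unique) asymptotic center of the sequence `x`. -/
def IsAsymptoticCenter {X : Type} [MetricSpace X] (x : ℕ → X) (a : X) : Prop :=
  (∀ z : X, asymRadius x a ≤ asymRadius x z) ∧
  ∀ b : X, (∀ z : X, asymRadius x b ≤ asymRadius x z) → b = a

/-- Weak sequential convergence: `a` is the asymptotic center of every subsequence. -/
def WeakSeqConv {X : Type} [MetricSpace X] (x : ℕ → X) (a : X) : Prop :=
  ∀ φ : ℕ → ℕ, StrictMono φ → IsAsymptoticCenter (fun n => x (φ n)) a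

end Defs

/-- A quantitative form of uniform `p`-convexity on bounded sets. -/
theorem UniformlyPConvexR.exists_gap {X : Type} [MetricSpace X] {p : ℝ} (hp : 1 < p)
    (huc : UniformlyPConvexR X p) (D : ℝ) {η : ℝ} (hη : 0 < η) :
    ∃ σ : ℝ, 0 < σ ∧ ∀ y y' : X, η ≤ dist y y' → ∃ m : X, ∀ z : X,
      dist z y ≤ D → dist z y' ≤ D →
        dist z m ^ p + σ ≤ (dist z y ^ p + dist z y' ^ p) / 2 := by
  have hp0 : 0 < p := by linarith
  obtain ⟨ρ, ⟨hρ0, hρ1⟩, hρ⟩ := huc.2 (η / (2 * (|D| + 1))) (by positivity)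
  refine ⟨ρ * (η / 2) ^ p, by positivity, fun y y' hyy => ?_⟩
  obtain ⟨m, hm⟩ := huc.1 y y'
  refine ⟨m, fun z hy hy' => ?_⟩
  set A : ℝ := (dist z y ^ p + dist z y' ^ p) / 2 with hA
  have hA0 : 0 ≤ A := by positivity
  set M : ℝ := pMeanR p (dist y z) (dist y' z) with hM
  have hMA : M = A ^ (1 / p) := by
    simp only [hM, pMeanR, hA, dist_comm]
  have hM0 : 0 ≤ M := hMA ▸ Real.rpow_nonneg hA0 _
  have hMp : M ^ p = A := by
    rw [hMA, ← Real.rpow_mul hA0, one_div_mul_cancel hp0.ne', Real.rpow_one]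
  have hMD : M ≤ |D| := by
    rw [← Real.rpow_le_rpow_iff hM0 (abs_nonneg D) hp0, hMp, hA]
    have h1 := Real.rpow_le_rpow dist_nonneg (hy.trans (le_abs_self D)) hp0.le
    have h2 := Real.rpow_le_rpow dist_nonneg (hy'.trans (le_abs_self D)) hp0.le
    linarith
  have hηM : (η / 2) ^ p ≤ A := by
    have hconv := (convexOn_rpow hp.le).2
      (Set.mem_Ici.2 (dist_nonneg (x := z) (y := y)))
      (Set.mem_Ici.2 (dist_nonneg (x := z) (y := y')))
      (by norm_num : (0 : ℝ) ≤ 1 / 2) (by norm_num : (0 : ℝ) ≤ 1 / 2) (by norm_num)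
    simp only [smul_eq_mul] at hconv
    have htri := dist_triangle_left y y' z
    have h1 : (η / 2) ^ p ≤ (1 / 2 * dist z y + 1 / 2 * dist z y') ^ p :=
      Real.rpow_le_rpow (by positivity) (by linarith) hp0.le
    linarith
  have hlt : η / (2 * (|D| + 1)) * M < dist y y' := by
    refine lt_of_lt_of_le ?_ hyy
    rw [div_mul_eq_mul_div, div_lt_iff₀ (by positivity)]
    have := abs_nonneg D
    nlinarith
  have hmz : dist z m ≤ (1 - ρ) * M := dist_comm m z ▸ hρ y y' z m hm hlt
  have h1 : dist z m ^ p ≤ (1 - ρ) ^ p * A := by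
    rw [← hMp, ← Real.mul_rpow (by linarith) hM0]
    exact Real.rpow_le_rpow dist_nonneg hmz hp0.le
  have h2 : (1 - ρ) ^ p ≤ 1 - ρ := by
    simpa using Real.rpow_le_rpow_of_exponent_ge (by linarith : 0 < 1 - ρ) (by linarith) hp.le
  nlinarith

/-- Summed version of `UniformlyPConvexR.exists_gap`. -/
theorem UniformlyPConvexR.exists_sum_gap {X : Type} [MetricSpace X] {p : ℝ} (hp : 1 < p)
    (huc : UniformlyPConvexR X p) (D : ℝ) {η : ℝ} (hη : 0 < η) :
    ∃ σ : ℝ, 0 < σ ∧ ∀ (S : Finset ℕ) (u : ℕ → X) (y y' : X), η ≤ dist y y' →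
      (∀ i ∈ S, dist (u i) y ≤ D) → (∀ i ∈ S, dist (u i) y' ≤ D) →
        ∃ m : X, ∑ i ∈ S, dist (u i) m ^ p + S.card * σ ≤
          (∑ i ∈ S, dist (u i) y ^ p + ∑ i ∈ S, dist (u i) y' ^ p) / 2 := by
  obtain ⟨σ, hσ, h⟩ := huc.exists_gap hp D hη
  refine ⟨σ, hσ, fun S u y y' hyy hy hy' => ?_⟩
  obtain ⟨m, hm⟩ := h y y' hyy
  refine ⟨m, ?_⟩
  rw [← Finset.sum_add_distrib, Finset.sum_div, ← nsmul_eq_mul, ← Finset.sum_const,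
    ← Finset.sum_add_distrib]
  exact Finset.sum_le_sum fun i hi => hm _ (hy i hi) (hy' i hi)

/-- Two points at which the energy exceeds its infimum by little are close. -/
theorem UniformlyPConvexR.exists_dist_lt_of_sum_le {X : Type} [MetricSpace X] {p : ℝ}
    (hp : 1 < p) (huc : UniformlyPConvexR X p) (u : ℕ → X) {S : Finset ℕ} (hS : S.Nonempty)
    (I : ℝ) (hI : ∀ y, I ≤ ∑ i ∈ S, dist (u i) y ^ p) {η : ℝ} (hη : 0 < η) :
    ∃ σ : ℝ, 0 < σ ∧ ∀ y y' : X, ∑ i ∈ S, dist (u i) y ^ p ≤ I + σ →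
      ∑ i ∈ S, dist (u i) y' ^ p ≤ I + σ → dist y y' < η := by
  have hp0 : 0 < p := by linarith
  obtain ⟨σ, hσ, h⟩ := huc.exists_sum_gap hp (|I + 1| ^ (1 / p)) hη
  have hbd : ∀ y : X, ∑ i ∈ S, dist (u i) y ^ p ≤ I + 1 →
      ∀ i ∈ S, dist (u i) y ≤ |I + 1| ^ (1 / p) := by
    intro y hy i hi
    have h1 : dist (u i) y ^ p ≤ ∑ j ∈ S, dist (u j) y ^ p :=
      Finset.single_le_sum (f := fun j => dist (u j) y ^ p)
        (fun j _ => Real.rpow_nonneg dist_nonneg p) hi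
    rw [← Real.rpow_le_rpow_iff dist_nonneg (by positivity) hp0,
      ← Real.rpow_mul (abs_nonneg _), one_div_mul_cancel hp0.ne', Real.rpow_one]
    linarith [le_abs_self (I + 1)]
  refine ⟨min (σ / 2) 1, by positivity, fun y y' hy hy' => ?_⟩
  by_contra! hlt
  have hl1 := min_le_left (σ / 2) 1
  have hl2 := min_le_right (σ / 2) 1
  obtain ⟨m, hm⟩ := h S u y y' hlt (hbd y (by linarith)) (hbd y' (by linarith))
  have hc : (1 : ℝ) ≤ S.card := by exact_mod_cast hS.card_pos
  have := hI m
  nlinarith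

/-- Existence of `p`-barycenters of finite families. -/
theorem UniformlyPConvexR.exists_barycenter {X : Type} [MetricSpace X] [CompleteSpace X]
    {p : ℝ} (hp : 1 < p) (huc : UniformlyPConvexR X p) (u : ℕ → X) {S : Finset ℕ}
    (hS : S.Nonempty) :
    ∃ b : X, ∀ y, ∑ i ∈ S, dist (u i) b ^ p ≤ ∑ i ∈ S, dist (u i) y ^ p := by
  have hp0 : 0 < p := by linarith
  have : Nonempty X := ⟨u 0⟩
  have hbdd : BddBelow (Set.range fun y => ∑ i ∈ S, dist (u i) y ^ p) :=
    ⟨0, by rintro _ ⟨y, rfl⟩; positivity⟩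
  set I : ℝ := ⨅ y, ∑ i ∈ S, dist (u i) y ^ p
  have hI : ∀ y, I ≤ ∑ i ∈ S, dist (u i) y ^ p := fun y => ciInf_le hbdd y
  have hex : ∀ k : ℕ, ∃ y, ∑ i ∈ S, dist (u i) y ^ p < I + 1 / ((k : ℝ) + 1) := fun k =>
    exists_lt_of_ciInf_lt (lt_add_of_pos_right _ Nat.one_div_pos_of_nat)
  choose y hy using hex
  have htend : Tendsto (fun k : ℕ => I + 1 / ((k : ℝ) + 1)) atTop (𝓝 I) := by
    simpa using tendsto_one_div_add_atTop_nhds_zero_nat.const_add I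
  have hcau : CauchySeq y := by
    refine Metric.cauchySeq_iff.2 fun η hη => ?_
    obtain ⟨σ, hσ, h⟩ := huc.exists_dist_lt_of_sum_le hp u hS I hI hη
    obtain ⟨K, hK⟩ := eventually_atTop.1 (htend.eventually_lt_const (lt_add_of_pos_right I hσ))
    exact ⟨K, fun i hi j hj => h _ _ ((hy i).le.trans (hK i hi).le)
      ((hy j).le.trans (hK j hj).le)⟩
  obtain ⟨b, hb⟩ := cauchySeq_tendsto_of_complete hcau
  refine ⟨b, fun z => le_trans ?_ (hI z)⟩
  have hlim : Tendsto (fun k => ∑ i ∈ S, dist (u i) (y k) ^ p) atTop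
      (𝓝 (∑ i ∈ S, dist (u i) b ^ p)) :=
    tendsto_finsetSum _ fun i _ =>
      (tendsto_const_nhds.dist hb).rpow_const (Or.inr hp0.le)
  exact le_of_tendsto_of_tendsto' hlim htend fun k => (hy k).le

/-- Uniqueness of `p`-barycenters of finite families. -/
theorem UniformlyPConvexR.barycenter_unique {X : Type} [MetricSpace X]
    {p : ℝ} (hp : 1 < p) (huc : UniformlyPConvexR X p) (u : ℕ → X) {S : Finset ℕ}
    (hS : S.Nonempty) {b b' : X}
    (hb : ∀ y, ∑ i ∈ S, dist (u i) b ^ p ≤ ∑ i ∈ S, dist (u i) y ^ p)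
    (hb' : ∀ y, ∑ i ∈ S, dist (u i) b' ^ p ≤ ∑ i ∈ S, dist (u i) y ^ p) : b' = b := by
  by_contra hne
  obtain ⟨σ, hσ, h⟩ := huc.exists_dist_lt_of_sum_le hp u hS _ hb (dist_pos.2 hne)
  exact lt_irrefl _ (h b' b (by linarith [hb' b]) (by linarith))

/-- A barycenter of points within distance `R` of `a` is within distance `3 * R` of them. -/
theorem dist_barycenter_le {X : Type} [MetricSpace X] {p : ℝ} (hp : 0 < p) {u : ℕ → X} {a : X}
    {R : ℝ} (hR : ∀ i, dist (u i) a ≤ R) {S : Finset ℕ} (hS : S.Nonempty) {b : X}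
    (hb : ∑ i ∈ S, dist (u i) b ^ p ≤ ∑ i ∈ S, dist (u i) a ^ p) (j : ℕ) :
    dist (u j) b ≤ 3 * R := by
  obtain ⟨i, -, hi⟩ := Finset.exists_le_of_sum_le hS hb
  have h1 : dist (u i) b ≤ dist (u i) a := (Real.rpow_le_rpow_iff dist_nonneg dist_nonneg hp).1 hi
  have h2 := dist_triangle4 (u j) a (u i) b
  rw [dist_comm a (u i)] at h2
  linarith [hR i, hR j]

/-- Weak sequential convergence to `a` of a sequence whose distance to `a` converges to `r`
makes every other point asymptotically at distance at least `r`. -/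
theorem WeakSeqConv.eventually_lt_dist {X : Type} [MetricSpace X] {x : ℕ → X} {a : X}
    (hw : WeakSeqConv x a) {ψ : ℕ → ℕ} (hψ : StrictMono ψ) {r : ℝ}
    (hr : Tendsto (fun n => dist (x (ψ n)) a) atTop (𝓝 r)) (y : X) {s : ℝ} (hs : s < r) :
    ∀ᶠ n in atTop, s < dist (x (ψ n)) y := by
  by_contra hcon
  obtain ⟨θ, hθ, hθs⟩ := extraction_of_frequently_atTop (not_eventually.1 hcon)
  have h1 := (hw (ψ ∘ θ) (hψ.comp hθ)).1 y
  have h2 : asymRadius (fun n => x ((ψ ∘ θ) n)) a = r := by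
    refine Tendsto.limsup_eq ?_
    simpa [dist_comm, Function.comp_def] using hr.comp hθ.tendsto_atTop
  have h3 : asymRadius (fun n => x ((ψ ∘ θ) n)) y ≤ s := by
    refine limsup_le_of_le ?_ (Eventually.of_forall fun n => ?_)
    · exact isCoboundedUnder_le_of_le atTop (x := 0) fun n => dist_nonneg
    · simpa [dist_comm] using hθs n
  linarith

/-- Greedy selection of a subsequence, each term depending on the set of previous ones. -/
theorem exists_strictMono_forall_image_range (P : Finset ℕ → ℕ → Prop)
    (hP : ∀ S, ∀ᶠ n in atTop, P S n) :
    ∃ φ : ℕ → ℕ, StrictMono φ ∧ ∀ N, P ((Finset.range N).image φ) (φ N) := by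
  have hex : ∀ S : Finset ℕ, ∃ n, P S n ∧ ∀ i ∈ S, i < n := fun S =>
    ((hP S).and ((Finset.eventually_all S).2 fun i _ => eventually_gt_atTop i)).exists
  choose c hc hlt using hex
  let T : ℕ → Finset ℕ := fun N => Nat.rec ∅ (fun _ S => insert (c S) S) N
  have hT : ∀ N, T N = (Finset.range N).image fun n => c (T n) := by
    intro N
    induction N with
    | zero => rfl
    | succ N ih =>
      rw [Finset.range_add_one, Finset.image_insert, ← ih]
  refine ⟨fun n => c (T n), strictMono_nat_of_lt_succ fun N => hlt _ _ ?_, fun N => ?_⟩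
  · exact Finset.mem_insert_self _ _
  · rw [← hT]
    exact hc _

/-- If each new point is almost at distance `r` from the barycenter of the previous ones, and
the distances to `a` converge to `r`, then the barycenters converge to `a`. -/
theorem UniformlyPConvexR.tendsto_barycenter {X : Type} [MetricSpace X] {p : ℝ}
    (hp : 1 < p) (huc : UniformlyPConvexR X p) {u : ℕ → X} {a : X} {r R : ℝ}
    (hR : ∀ i, dist (u i) a ≤ R) (hr : Tendsto (fun n => dist (u n) a) atTop (𝓝 r)) {b : ℕ → X}
    (hb : ∀ N, 0 < N → ∀ y, ∑ n ∈ Finset.range N, dist (u n) (b N) ^ p ≤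
      ∑ n ∈ Finset.range N, dist (u n) y ^ p)
    (hfar : ∀ N : ℕ, r - 1 / ((N : ℝ) + 1) < dist (u N) (b N)) :
    Tendsto b atTop (𝓝 a) := by
  have hp0 : 0 < p := by linarith
  have hD : ∀ N, 0 < N → ∀ j, dist (u j) (b N) ≤ 3 * R := fun N hN j =>
    dist_barycenter_le hp0 hR (Finset.nonempty_range_iff.2 hN.ne') (hb N hN a) j
  have hD' : ∀ j, dist (u j) a ≤ 3 * R := fun j => by
    linarith [hR j, dist_nonneg (x := u j) (y := a)]
  have hstep : Tendsto (fun N => dist (b N) (b (N + 1))) atTop (𝓝 0) := by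
    refine Metric.tendsto_atTop.2 fun η hη => ?_
    obtain ⟨σ, hσ, h⟩ := huc.exists_sum_gap hp (3 * R) hη
    obtain ⟨K, hK⟩ := exists_nat_gt ((3 * R) ^ p / (2 * σ))
    refine ⟨K + 1, fun N hN => ?_⟩
    have hN0 : 0 < N := by omega
    rw [Real.dist_0_eq_abs, abs_of_nonneg dist_nonneg]
    by_contra! hge
    obtain ⟨m, hm⟩ := h (Finset.range N) u _ _ hge (fun i _ => hD N hN0 i)
      (fun i _ => hD (N + 1) N.succ_pos i)
    have h1 := hb N hN0 m
    have h2 := hb (N + 1) N.succ_pos (b N)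
    rw [Finset.sum_range_succ, Finset.sum_range_succ _ N] at h2
    have h3 : 0 ≤ dist (u N) (b (N + 1)) ^ p := Real.rpow_nonneg dist_nonneg p
    have h4 := Real.rpow_le_rpow dist_nonneg (hD N hN0 N) hp0.le
    rw [div_lt_iff₀ (by positivity)] at hK
    have h5 : (K : ℝ) ≤ N := by exact_mod_cast (by omega : K ≤ N)
    rw [Finset.card_range] at hm
    nlinarith
  set w : ℕ → ℝ := fun N => min (dist (u N) (b (N + 1))) r ^ p
  have hr0 : 0 ≤ r := ge_of_tendsto' hr fun n => dist_nonneg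
  have hmin : Tendsto (fun N => min (dist (u N) (b (N + 1))) r) atTop (𝓝 r) := by
    have hlow : Tendsto (fun N : ℕ => r - 1 / ((N : ℝ) + 1) - dist (b N) (b (N + 1))) atTop
        (𝓝 r) := by
      simpa using (tendsto_one_div_add_atTop_nhds_zero_nat.const_sub r).sub hstep
    refine tendsto_of_tendsto_of_tendsto_of_le_of_le hlow tendsto_const_nhds (fun N => ?_)
      fun N => min_le_right _ _
    have h1 : (0 : ℝ) < 1 / ((N : ℝ) + 1) := Nat.one_div_pos_of_nat
    have h2 := dist_triangle_right (u N) (b N) (b (N + 1))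
    exact le_min (by linarith [hfar N]) (by linarith [dist_nonneg (x := b N) (y := b (N + 1))])
  have hwlim : Tendsto w atTop (𝓝 (r ^ p)) := hmin.rpow_const (Or.inr hp0.le)
  have hsum : ∀ N, ∑ n ∈ Finset.range N, w n ≤ ∑ n ∈ Finset.range N, dist (u n) (b N) ^ p := by
    intro N
    induction N with
    | zero => simp
    | succ N ih =>
      rw [Finset.sum_range_succ, Finset.sum_range_succ]
      have h1 : w N ≤ dist (u N) (b (N + 1)) ^ p :=
        Real.rpow_le_rpow (le_min dist_nonneg hr0) (min_le_left _ _) hp0.le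
      have h2 : ∑ n ∈ Finset.range N, dist (u n) (b N) ^ p ≤
          ∑ n ∈ Finset.range N, dist (u n) (b (N + 1)) ^ p := by
        rcases N.eq_zero_or_pos with rfl | hN
        · simp
        · exact hb N hN _
      linarith
  have hces : Tendsto (fun N : ℕ => (N : ℝ)⁻¹ * ∑ n ∈ Finset.range N, (dist (u n) a ^ p - w n))
      atTop (𝓝 0) := by
    have := ((hr.rpow_const (Or.inr hp0.le : r ≠ 0 ∨ 0 ≤ p)).sub hwlim).cesaro
    rwa [sub_self] at this
  refine Metric.tendsto_atTop.2 fun η hη => ?_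
  obtain ⟨σ, hσ, h⟩ := huc.exists_sum_gap hp (3 * R) hη
  obtain ⟨K, hK⟩ := eventually_atTop.1 (hces.eventually_lt_const hσ)
  refine ⟨K + 1, fun N hN => ?_⟩
  have hN0 : 0 < N := by omega
  by_contra! hge
  obtain ⟨m, hm⟩ := h (Finset.range N) u _ _ hge (fun i _ => hD N hN0 i) (fun i _ => hD' i)
  have h1 := hb N hN0 m
  have h2 := hsum N
  have h3 := hK N (by omega)
  have hNR : (0 : ℝ) < N := by exact_mod_cast hN0
  rw [inv_mul_lt_iff₀ hNR, Finset.sum_sub_distrib] at h3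
  rw [Finset.card_range] at hm
  nlinarith [mul_pos hNR hσ]

/-- Banach–Saks: in a complete uniformly `p`-convex space, if `x_n →ʷ x`
then some subsequence has the property that the (unique) `p`-barycenters of its empirical
measures converge strongly to `x`. -/
theorem banach_saks (X : Type) [MetricSpace X] [CompleteSpace X] (p : ℝ) (hp : 1 < p)
    (huc : UniformlyPConvexR X p) (x : ℕ → X) (hb : Bornology.IsBounded (Set.range x))
    (a : X) (hw : WeakSeqConv x a) :
    ∃ φ : ℕ → ℕ, StrictMono φ ∧ ∃ b : ℕ → X,
      (∀ N : ℕ, 0 < N →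
        (∀ y : X, (1 / (N:ℝ)) * ∑ n ∈ Finset.range N, dist (x (φ n)) (b N) ^ p ≤
          (1 / (N:ℝ)) * ∑ n ∈ Finset.range N, dist (x (φ n)) y ^ p) ∧
        (∀ b' : X, (∀ y : X, (1 / (N:ℝ)) * ∑ n ∈ Finset.range N, dist (x (φ n)) b' ^ p ≤
          (1 / (N:ℝ)) * ∑ n ∈ Finset.range N, dist (x (φ n)) y ^ p) → b' = b N)) ∧
      Filter.Tendsto b Filter.atTop (nhds a) := by
  have hp0 : 0 < p := by linarith
  obtain ⟨R, hR⟩ := hb.subset_closedBall a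
  have hR' : ∀ n, dist (x n) a ≤ R := fun n => hR (Set.mem_range_self n)
  obtain ⟨r, -, ψ, hψ, hr⟩ := tendsto_subseq_of_bounded (Metric.isBounded_Icc (0 : ℝ) R)
    (x := fun n => dist (x n) a) fun n => ⟨dist_nonneg, hR' n⟩
  have hex : ∀ S : Finset ℕ, ∃ b : X, S.Nonempty → ∀ y,
      ∑ i ∈ S, dist (x (ψ i)) b ^ p ≤ ∑ i ∈ S, dist (x (ψ i)) y ^ p := by
    intro S
    by_cases hS : S.Nonempty
    · obtain ⟨b, hb⟩ := huc.exists_barycenter hp (fun i => x (ψ i)) hS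
      exact ⟨b, fun _ => hb⟩
    · exact ⟨a, fun h => absurd h hS⟩
  choose B hB using hex
  obtain ⟨θ, hθ, hfar⟩ := exists_strictMono_forall_image_range
    (fun S n => r - 1 / ((S.card : ℝ) + 1) < dist (x (ψ n)) (B S))
    fun S => hw.eventually_lt_dist hψ hr (B S) (sub_lt_self r Nat.one_div_pos_of_nat)
  set b : ℕ → X := fun N => B ((Finset.range N).image θ)
  have hmin : ∀ N, 0 < N → ∀ y, ∑ n ∈ Finset.range N, dist (x (ψ (θ n))) (b N) ^ p ≤
      ∑ n ∈ Finset.range N, dist (x (ψ (θ n))) y ^ p := by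
    intro N hN y
    have h := hB ((Finset.range N).image θ)
      ((Finset.nonempty_range_iff.2 hN.ne').image θ) y
    rwa [Finset.sum_image hθ.injective.injOn, Finset.sum_image hθ.injective.injOn] at h
  refine ⟨ψ ∘ θ, hψ.comp hθ, b, fun N hN => ?_, ?_⟩
  · have hNR : (0 : ℝ) < 1 / N := by positivity
    simp only [mul_le_mul_iff_right₀ hNR, Function.comp_apply]
    exact ⟨hmin N hN, fun b' hb' => huc.barycenter_unique hp (fun n => x (ψ (θ n)))
      (Finset.nonempty_range_iff.2 hN.ne') (hmin N hN) hb'⟩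
  · refine huc.tendsto_barycenter hp (u := fun n => x (ψ (θ n))) (fun i => hR' _)
      (hr.comp hθ.tendsto_atTop) hmin fun N => ?_
    have h := hfar N
    rwa [Finset.card_image_of_injective _ hθ.injective, Finset.card_range] at h
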